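/- For any non-degenerate continuum K ⊆ ℝ^d (i.e., a compact connected set containing at least two points) there exists a rectifiable curve Γ (the image of a continuous map f : [a,b] → ℝ^d of finite length; equivalently, the image of a Lipschitz map from a compact interval) such that the intersection Γ ∩ K has Hausdorff dimension equal to 1. -/

import Mathlib

open MeasureTheory

/-- `K` is a compact connected subset of the closed ball of radius `r` about its point `p`, and
it reaches the boundary sphere of that ball. -/
structure IsSpanningContinuum {X : Type*} [MetricSpace X] (K : Set X) (p : X) (r : ℝ) : Prop where
  isCompact : IsCompact K
  isPreconnected : IsPreconnected K
  center_mem : p ∈ K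
  subset_closedBall : K ⊆ Metric.closedBall p r
  exists_dist_eq : ∃ q ∈ K, dist q p = r

/-- Boundary bumping: a continuum which leaves a ball about one of its points contains a
subcontinuum through that point which lies in the ball and reaches its boundary. -/
theorem IsPreconnected.exists_isSpanningContinuum_subset {X : Type*} [MetricSpace X] {K : Set X}
    (hK : IsCompact K) (hconn : IsPreconnected K) {p q : X} (hp : p ∈ K) (hq : q ∈ K) {r : ℝ}
    (hr : 0 < r) (hpq : r ≤ dist q p) :
    ∃ L ⊆ K, IsSpanningContinuum L p r := by
  set Y : Set X := K ∩ Metric.closedBall p r with hY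
  have hYc : IsCompact Y := hK.inter_right Metric.isClosed_closedBall
  have : CompactSpace Y := isCompact_iff_compactSpace.mp hYc
  have hpY : p ∈ Y := ⟨hp, Metric.mem_closedBall_self hr.le⟩
  let p' : Y := ⟨p, hpY⟩
  let C : Set Y := connectedComponent p'
  have hLY : (Subtype.val '' C : Set X) ⊆ Y := by
    rintro _ ⟨y, -, rfl⟩
    exact y.2
  refine ⟨Subtype.val '' C, hLY.trans Set.inter_subset_left, ?_, ?_, ?_, ?_, ?_⟩
  · exact isClosed_connectedComponent.isCompact.image continuous_subtype_val
  · exact isPreconnected_connectedComponent.image _ continuous_subtype_val.continuousOn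
  · exact ⟨p', mem_connectedComponent, rfl⟩
  · exact hLY.trans Set.inter_subset_right
  by_contra! hne
  have hsphere : IsClosed {y : Y | dist (y : X) p = r} :=
    isClosed_eq (by fun_prop) continuous_const
  have hdisj : {y : Y | dist (y : X) p = r} ∩
      ⋂ s : {s : Set Y // IsClopen s ∧ p' ∈ s}, (s : Set Y) = ∅ := by
    rw [← connectedComponent_eq_iInter_isClopen, Set.eq_empty_iff_forall_notMem]
    rintro y ⟨hy, hyC⟩
    exact hne y ⟨y, hyC, rfl⟩ hy
  have : Nonempty {s : Set Y // IsClopen s ∧ p' ∈ s} := ⟨⟨Set.univ, isClopen_univ, trivial⟩⟩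
  have hdir : Directed (· ⊇ ·) fun s : {s : Set Y // IsClopen s ∧ p' ∈ s} ↦ (s : Set Y) := by
    rintro ⟨s, hs, hps⟩ ⟨t, ht, hpt⟩
    exact ⟨⟨s ∩ t, hs.inter ht, hps, hpt⟩, Set.inter_subset_left, Set.inter_subset_right⟩
  obtain ⟨⟨F, hF, hpF⟩, hFs⟩ := hsphere.isCompact.elim_directed_family_closed _
    (fun s ↦ s.2.1.isClosed) hdisj hdir
  have hFball : ∀ y ∈ F, dist (y : X) p < r := fun y hy ↦
    lt_of_le_of_ne y.2.2 fun h ↦ Set.eq_empty_iff_forall_notMem.mp hFs y ⟨h, hy⟩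
  obtain ⟨U, hU, hUF⟩ := isOpen_induced_iff.mp hF.isOpen
  have hFc : IsClosed (Subtype.val '' F : Set X) :=
    (hF.isClosed.isCompact.image continuous_subtype_val).isClosed
  have hmem : ∀ x ∈ K, x ∈ U → dist x p < r → x ∈ (Subtype.val '' F : Set X) := by
    intro x hx hxU hxr
    refine ⟨⟨x, hx, hxr.le⟩, ?_, rfl⟩
    rw [← hUF]
    exact hxU
  have hpU : p ∈ U := by
    rw [← hUF] at hpF
    exact hpF
  obtain ⟨x, hxK, ⟨hxU, hxr⟩, hxF⟩ := hconn (U ∩ Metric.ball p r) (Subtype.val '' F)ᶜ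
    (hU.inter Metric.isOpen_ball) hFc.isOpen_compl
    (fun x hx ↦ by
      by_cases hxF : x ∈ (Subtype.val '' F : Set X)
      · obtain ⟨y, hy, rfl⟩ := hxF
        refine Or.inl ⟨?_, hFball y hy⟩
        rw [← hUF] at hy
        exact hy
      · exact Or.inr hxF)
    ⟨p, hp, hpU, Metric.mem_ball_self hr⟩
    ⟨q, hq, by
      rintro ⟨y, hy, rfl⟩
      exact (hFball y hy).not_ge hpq⟩
  exact hxF (hmem x hxK hxU hxr)

/-- A spanning continuum of radius `r` contains `N` well separated spanning continua of
radius `r / (4 * N)`. -/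
theorem IsSpanningContinuum.exists_separated_family {X : Type*} [MetricSpace X] {K : Set X}
    {p : X} {r : ℝ} (h : IsSpanningContinuum K p r) (hr : 0 < r) {N : ℕ} (hN : 0 < N) :
    ∃ (L : Fin N → Set X) (c : Fin N → X),
      (∀ i, IsSpanningContinuum (L i) (c i) (r / (4 * N))) ∧ (∀ i, L i ⊆ K) ∧
      ∀ i j, i ≠ j → ∀ x ∈ L i, ∀ y ∈ L j, r / (2 * N) ≤ dist x y := by
  obtain ⟨q, hq, hqr⟩ := h.exists_dist_eq
  have hN' : (1 : ℝ) ≤ N := by exact_mod_cast hN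
  have hcenter : ∀ i : Fin N, ∃ x ∈ K, dist x p = r * (i / N) := by
    intro i
    have hi : (i : ℝ) / N ≤ 1 := by
      rw [div_le_one (by positivity)]
      exact_mod_cast i.2.le
    have hIcc := h.isPreconnected.intermediate_value h.center_mem hq
      (f := fun x ↦ dist x p) (by fun_prop)
    simp only [dist_self, hqr] at hIcc
    exact hIcc ⟨by positivity, mul_le_of_le_one_right hr.le hi⟩
  choose c hcK hc using hcenter
  have hsmall : r / (4 * N) ≤ r / 2 := by
    gcongr
    linarith
  have hsub : ∀ i, ∃ L ⊆ K, IsSpanningContinuum L (c i) (r / (4 * N)) := by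
    intro i
    have htri := dist_triangle_right q p (c i)
    by_cases hi : r / 2 ≤ dist q (c i)
    · exact h.isPreconnected.exists_isSpanningContinuum_subset h.isCompact (hcK i) hq
        (by positivity) (hsmall.trans hi)
    · exact h.isPreconnected.exists_isSpanningContinuum_subset h.isCompact (hcK i) h.center_mem
        (by positivity) (by linarith)
  choose L hLK hL using hsub
  refine ⟨L, c, hL, hLK, fun i j hij x hx y hy ↦ ?_⟩
  have hx' : dist x (c i) ≤ r / (4 * N) := (hL i).subset_closedBall hx
  have hy' : dist y (c j) ≤ r / (4 * N) := (hL j).subset_closedBall hy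
  have hij' : (1 : ℝ) ≤ |(i : ℝ) - j| := by
    have : (1 : ℤ) ≤ |(i : ℤ) - j| := Int.one_le_abs (by
      rw [sub_ne_zero]
      exact_mod_cast fun h ↦ hij (Fin.ext h))
    exact_mod_cast this
  have hcc : r / N ≤ dist (c i) (c j) := by
    have := abs_dist_sub_le (c i) (c j) p
    rw [hc, hc] at this
    refine le_trans ?_ this
    rw [show r * ((i : ℝ) / N) - r * (j / N) = r / N * (i - j) by ring, abs_mul,
      abs_of_nonneg (by positivity : 0 ≤ r / (N : ℝ))]
    exact le_mul_of_one_le_right (by positivity) hij'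
  have h4 := dist_triangle4 (c i) x y (c j)
  rw [dist_comm (c i) x] at h4
  have e1 : r / (4 * N) = r / N / 4 := by field_simp
  have e2 : r / (2 * N) = r / N / 2 := by field_simp
  rw [e1] at hx' hy'
  rw [e2]
  linarith

/-- A spanning continuum contains a Cantor set whose metric is comparable with the one of the
self-similar Cantor set with `N` pieces of ratio `1 / (4 * N)`. -/
theorem IsSpanningContinuum.exists_coding {X : Type*} [MetricSpace X] {K : Set X}
    {p : X} {r : ℝ} (h : IsSpanningContinuum K p r) (hr : 0 < r) {N : ℕ} (hN : 0 < N) :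
    ∃ x : (ℕ → Fin N) → X, (∀ a, x a ∈ K) ∧ ∀ a b k, (∀ i < k, a i = b i) →
      dist (x a) (x b) ≤ 2 * (r / (4 * N) ^ k) ∧
      (a k ≠ b k → r / (4 * N) ^ k / (2 * N) ≤ dist (x a) (x b)) := by
  have hstep : ∀ s : {T : Set X × X × ℝ // 0 < T.2.2 ∧ IsSpanningContinuum T.1 T.2.1 T.2.2},
      ∃ c : Fin N → {T : Set X × X × ℝ // 0 < T.2.2 ∧ IsSpanningContinuum T.1 T.2.1 T.2.2},
        (∀ i, (c i).1.2.2 = s.1.2.2 / (4 * N)) ∧ (∀ i, (c i).1.1 ⊆ s.1.1) ∧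
        ∀ i j, i ≠ j → ∀ x ∈ (c i).1.1, ∀ y ∈ (c j).1.1, s.1.2.2 / (2 * N) ≤ dist x y := by
    rintro ⟨⟨K, p, r⟩, hr, h⟩
    obtain ⟨L, c, hL, hLK, hsep⟩ := h.exists_separated_family hr hN
    refine ⟨fun i ↦ ⟨(L i, c i, r / (4 * N)), ?_, hL i⟩, fun _ ↦ rfl, hLK, hsep⟩
    dsimp only at hr ⊢
    positivity
  choose child hrad hsub hsep using hstep
  let node (a : ℕ → Fin N) (k : ℕ) :=
    Nat.rec (motive := fun _ ↦
      {T : Set X × X × ℝ // 0 < T.2.2 ∧ IsSpanningContinuum T.1 T.2.1 T.2.2})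
      ⟨(K, p, r), hr, h⟩ (fun k s ↦ child s (a k)) k
  have node_succ : ∀ a k, node a (k + 1) = child (node a k) (a k) := fun _ _ ↦ rfl
  have node_rad : ∀ a k, (node a k).1.2.2 = r / (4 * N) ^ k := by
    intro a k
    induction k with
    | zero => simp [node]
    | succ k ih => rw [node_succ, hrad, ih, div_div, pow_succ]
  have node_congr : ∀ a b k, (∀ i < k, a i = b i) → node a k = node b k := by
    intro a b k hab
    induction k with
    | zero => rfl
    | succ k ih =>
      rw [node_succ, node_succ, ih fun i hi ↦ hab i (hi.trans k.lt_succ_self),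
        hab k k.lt_succ_self]
  have hne : ∀ a, (⋂ k, (node a k).1.1).Nonempty := fun a ↦
    IsCompact.nonempty_iInter_of_sequence_nonempty_isCompact_isClosed _
      (fun k ↦ by rw [node_succ]; exact hsub _ _) (fun k ↦ ⟨_, (node a k).2.2.center_mem⟩)
      (node a 0).2.2.isCompact (fun k ↦ (node a k).2.2.isCompact.isClosed)
  choose x hx using hne
  simp only [Set.mem_iInter] at hx
  refine ⟨x, fun a ↦ hx a 0, fun a b k hab ↦ ⟨?_, fun hk ↦ ?_⟩⟩
  · have ha := (node a k).2.2.subset_closedBall (hx a k)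
    have hb := (node a k).2.2.subset_closedBall (node_congr a b k hab ▸ hx b k)
    rw [node_rad] at ha hb
    rw [Metric.mem_closedBall] at ha hb
    linarith [dist_triangle_right (x a) (x b) (node a k).1.2.1]
  · have ha := hx a (k + 1)
    have hb := hx b (k + 1)
    rw [node_succ] at ha hb
    rw [← node_congr a b k hab] at hb
    have := hsep _ _ _ hk _ ha _ hb
    rwa [node_rad] at this

theorem Real.ofDigits_castLE_le {N M : ℕ} (hNM : N ≤ M) (a : ℕ → Fin N) :
    Real.ofDigits (fun i ↦ Fin.castLE hNM (a i)) ≤ N / M := by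
  have hN : 0 < N := Fin.pos (a 0)
  have hM : (0 : ℝ) < M := by exact_mod_cast hN.trans_le hNM
  have h1 := Real.ofDigits_le_one (fun i ↦ Fin.castLE hNM (a (i + 1)))
  have h0 : ((a 0 : ℕ) : ℝ) + 1 ≤ N := by exact_mod_cast (a 0).2
  rw [Real.ofDigits_eq_sum_add_ofDigits _ 1]
  simp only [Finset.range_one, Finset.sum_singleton, Real.ofDigitsTerm, Fin.val_castLE, zero_add,
    pow_one, ← div_eq_mul_inv, inv_mul_eq_div]
  rw [← add_div]
  gcongr
  linarith

/-- Lower bound for the distance of two points of a self-similar Cantor set whose codes differ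
at the index `k`. -/
theorem Real.le_abs_ofDigits_castLE_sub {N M : ℕ} (hNM : N ≤ M) {a b : ℕ → Fin N} {k : ℕ}
    (hab : ∀ i < k, a i = b i) (hk : a k ≠ b k) :
    (1 - N / M) * ((M : ℝ) ^ (k + 1))⁻¹ ≤
      |Real.ofDigits (fun i ↦ Fin.castLE hNM (a i)) -
        Real.ofDigits (fun i ↦ Fin.castLE hNM (b i))| := by
  wlog hlt : b k < a k generalizing a b
  · rw [abs_sub_comm]
    exact this (fun i hi ↦ (hab i hi).symm) hk.symm (lt_of_le_of_ne (not_lt.mp hlt) hk)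
  refine le_trans ?_ (le_abs_self _)
  have hlt' : ((b k : ℕ) : ℝ) + 1 ≤ (a k : ℕ) := by exact_mod_cast hlt
  have hta := Real.ofDigits_nonneg (fun i ↦ Fin.castLE hNM (a (i + (k + 1))))
  have htb := Real.ofDigits_castLE_le hNM (fun i ↦ b (i + (k + 1)))
  rw [Real.ofDigits_eq_sum_add_ofDigits (fun i ↦ Fin.castLE hNM (a i)) (k + 1),
    Real.ofDigits_eq_sum_add_ofDigits (fun i ↦ Fin.castLE hNM (b i)) (k + 1),
    Finset.sum_range_succ, Finset.sum_range_succ]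
  have hsum : ∑ i ∈ Finset.range k, Real.ofDigitsTerm (fun i ↦ Fin.castLE hNM (a i)) i =
      ∑ i ∈ Finset.range k, Real.ofDigitsTerm (fun i ↦ Fin.castLE hNM (b i)) i :=
    Finset.sum_congr rfl fun i hi ↦ by
      simp [Real.ofDigitsTerm, hab i (Finset.mem_range.mp hi)]
  rw [hsum]
  simp only [Real.ofDigitsTerm, Fin.val_castLE]
  have hpos : 0 ≤ ((M : ℝ) ^ (k + 1))⁻¹ := by positivity
  generalize ((M : ℝ) ^ (k + 1))⁻¹ = t at *
  nlinarith [mul_nonneg hpos hta, mul_le_mul_of_nonneg_left htb hpos,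
    mul_le_mul_of_nonneg_left hlt' hpos]

/-- Two distinct sequences have a first index at which they differ. -/
theorem exists_forall_lt_eq_and_ne {α : Type*} {a b : ℕ → α} (hab : a ≠ b) :
    ∃ k, (∀ i < k, a i = b i) ∧ a k ≠ b k := by
  classical
  have hex : ∃ k, a k ≠ b k := Function.ne_iff.mp hab
  exact ⟨Nat.find hex, fun i hi ↦ not_not.mp (Nat.find_min hex hi), Nat.find_spec hex⟩

/-- If the coding map of a Cantor set separates first differences as much as the self-similar
Cantor set with `4 ^ m` pieces of ratio `1 / 4 ^ (m + 1)` does, then the Cantor set has dimension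
at least `m / (m + 1)`. -/
theorem le_dimH_range_of_coding {X : Type*} [MetricSpace X] {m : ℕ} (hm : 0 < m)
    {x : (ℕ → Fin (4 ^ m)) → X} {c : ℝ} (hc : 0 < c)
    (hx : ∀ a b k, (∀ i < k, a i = b i) → a k ≠ b k → c / (4 ^ (m + 1)) ^ k ≤ dist (x a) (x b)) :
    (m / (m + 1) : NNReal) ≤ dimH (Set.range x) := by
  have hinj : Function.Injective x := by
    intro a b hab
    by_contra hne
    obtain ⟨k, hk, hk'⟩ := exists_forall_lt_eq_and_ne hne
    have := hx a b k hk hk'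
    rw [hab, dist_self] at this
    exact this.not_gt (by positivity)
  set s : NNReal := m / (m + 1) with hs
  have hs0 : 0 < s := by positivity
  have hsr : (s : ℝ) = m / (m + 1) := by simp [hs]
  set C : NNReal := ⟨(1 / c) ^ (s : ℝ), by positivity⟩
  have hone : 1 < 4 ^ m := Nat.one_lt_pow hm.ne' (by norm_num)
  have : Nonempty (ℕ → Fin (4 ^ m)) := ⟨fun _ ↦ ⟨0, by positivity⟩⟩
  have hholder : HolderOnWith C s (Real.ofDigits ∘ Function.invFun x) (Set.range x) := by
    rintro _ ⟨a, rfl⟩ _ ⟨b, rfl⟩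
    simp only [Function.comp, Function.leftInverse_invFun hinj _]
    rw [edist_dist, edist_dist, ENNReal.ofReal_rpow_of_nonneg dist_nonneg s.coe_nonneg,
      ← ENNReal.ofReal_coe_nnreal, ← ENNReal.ofReal_mul C.coe_nonneg]
    apply ENNReal.ofReal_le_ofReal
    by_cases hab : a = b
    · subst hab
      rw [dist_self]
      positivity
    obtain ⟨k, hk, hk'⟩ := exists_forall_lt_eq_and_ne hab
    have h1 := Real.abs_ofDigits_sub_ofDigits_le hk
    have h2 := hx a b k hk hk'
    rw [Real.dist_eq]
    refine h1.trans ?_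
    change _ ≤ (1 / c) ^ (s : ℝ) * _
    rw [← Real.mul_rpow (by positivity) dist_nonneg]
    have h3 : (((4 : ℝ) ^ (m + 1)) ^ k)⁻¹ ≤ 1 / c * dist (x a) (x b) := by
      rw [div_mul_eq_mul_div, one_mul, le_div_iff₀ hc]
      calc _ = c / (4 ^ (m + 1)) ^ k := by ring
        _ ≤ _ := h2
    refine le_trans (le_of_eq ?_) (Real.rpow_le_rpow (by positivity) h3 s.coe_nonneg)
    have hpow : (((4 : ℝ) ^ (m + 1)) ^ k) ^ (s : ℝ) = (4 ^ m) ^ k := by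
      rw [← pow_mul, ← pow_mul, ← Real.rpow_natCast, ← Real.rpow_natCast,
        ← Real.rpow_mul (by norm_num), hsr]
      congr 1
      push_cast
      field_simp
    rw [Real.inv_rpow (by positivity), hpow]
    push_cast
    rfl
  have hsurj : Set.Icc (0 : ℝ) 1 ⊆ (Real.ofDigits ∘ Function.invFun x) '' Set.range x := by
    intro t ht
    obtain ⟨a, -, rfl⟩ := Real.ofDigits_SurjOn hone ht
    exact ⟨x a, ⟨a, rfl⟩, by simp [Function.leftInverse_invFun hinj a]⟩
  have hdim : dimH (Set.Icc (0 : ℝ) 1) = 1 := by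
    rw [Real.dimH_of_mem_nhds (Icc_mem_nhds one_half_pos one_half_lt_one), Module.finrank_self,
      Nat.cast_one]
  have hle := (dimH_mono hsurj).trans (hholder.dimH_image_le hs0)
  rw [hdim, ENNReal.le_div_iff_mul_le (Or.inl (by simpa using hs0.ne')) (Or.inl (by simp)),
    one_mul] at hle
  exact hle

/-- Near each of its points, a non-degenerate continuum contains short Lipschitz images of subsets
of the line of dimension arbitrarily close to `1`. -/
theorem exists_lipschitzOnWith_le_dimH_image {X : Type*} [MetricSpace X] {K : Set X}
    (hK : IsCompact K) (hconn : IsPreconnected K) {p q : X} (hp : p ∈ K) (hq : q ∈ K)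
    (hpq : q ≠ p) {ε : ℝ} (hε : 0 < ε) {m : ℕ} (hm : 0 < m) :
    ∃ (S : Set ℝ) (g : ℝ → X), S ⊆ Set.Icc 0 ε ∧ LipschitzOnWith 1 g S ∧
      Set.MapsTo g S (K ∩ Metric.closedBall p ε) ∧ (m / (m + 1) : NNReal) ≤ dimH (g '' S) := by
  set N : ℕ := 4 ^ m with hN
  have hN0 : 0 < N := by positivity
  have hN1 : (1 : ℝ) ≤ N := by exact_mod_cast hN0
  set r : ℝ := min (dist q p) (ε / (16 * N)) with hr
  have hr0 : 0 < r := lt_min (dist_pos.mpr hpq) (by positivity)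
  have hrε : 16 * N * r ≤ ε := by
    have : r ≤ ε / (16 * N) := min_le_right _ _
    rwa [le_div_iff₀' (by positivity)] at this
  obtain ⟨L, hLK, hL⟩ := hconn.exists_isSpanningContinuum_subset hK hp hq hr0 (min_le_left _ _)
  obtain ⟨x, hxL, hx⟩ := hL.exists_coding hr0 hN0
  have hNM : N ≤ 4 * N := by omega
  let τ : (ℕ → Fin N) → ℝ := fun a ↦
    16 * N * r * Real.ofDigits (fun i ↦ Fin.castLE hNM (a i))
  have hlip : ∀ a b, dist (x a) (x b) ≤ |τ a - τ b| := by
    intro a b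
    by_cases hab : a = b
    · simp [hab]
    obtain ⟨k, hk, hk'⟩ := exists_forall_lt_eq_and_ne hab
    refine (hx a b k hk).1.trans ?_
    have hlow := Real.le_abs_ofDigits_castLE_sub hNM hk hk'
    simp only [τ, ← mul_sub]
    rw [abs_mul, abs_of_pos (by positivity : 0 < 16 * N * r)]
    refine le_trans ?_ (mul_le_mul_of_nonneg_left hlow (by positivity))
    push_cast
    have e : 16 * N * r * ((1 - N / (4 * N)) * ((4 * (N : ℝ)) ^ (k + 1))⁻¹) =
        3 * (r / (4 * N) ^ k) := by
      rw [pow_succ]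
      field_simp
      norm_num
    rw [e]
    have : 0 ≤ r / (4 * (N : ℝ)) ^ k := by positivity
    linarith
  have hxinj : Function.Injective x := by
    intro a b hab
    by_contra hne
    obtain ⟨k, hk, hk'⟩ := exists_forall_lt_eq_and_ne hne
    have := (hx a b k hk).2 hk'
    rw [hab, dist_self] at this
    exact this.not_gt (by positivity)
  have hτ : Function.Injective τ := by
    intro a b hab
    have := hlip a b
    rw [hab, sub_self, abs_zero] at this
    exact hxinj (dist_le_zero.mp this)
  have : Nonempty (ℕ → Fin N) := ⟨fun _ ↦ ⟨0, hN0⟩⟩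
  have hinv : ∀ a, (x ∘ Function.invFun τ) (τ a) = x a := fun a ↦
    congrArg x (Function.leftInverse_invFun hτ a)
  refine ⟨Set.range τ, x ∘ Function.invFun τ, ?_, ?_, ?_, ?_⟩
  · rintro _ ⟨a, rfl⟩
    have h0 := Real.ofDigits_nonneg (fun i ↦ Fin.castLE hNM (a i))
    have h1 := Real.ofDigits_le_one (fun i ↦ Fin.castLE hNM (a i))
    exact ⟨by positivity, (mul_le_of_le_one_right (by positivity) h1).trans hrε⟩
  · refine LipschitzOnWith.of_dist_le_mul ?_
    rintro _ ⟨a, rfl⟩ _ ⟨b, rfl⟩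
    rw [hinv, hinv, NNReal.coe_one, one_mul, Real.dist_eq]
    exact hlip a b
  · rintro _ ⟨a, rfl⟩
    rw [hinv]
    refine ⟨hLK (hxL a), Metric.closedBall_subset_closedBall ?_ (hL.subset_closedBall (hxL a))⟩
    nlinarith
  · have himage : (x ∘ Function.invFun τ) '' Set.range τ = Set.range x := by
      rw [← Set.range_comp]
      exact congrArg Set.range (funext hinv)
    rw [himage]
    refine le_dimH_range_of_coding hm (c := r / (2 * N)) (by positivity) fun a b k hk hk' ↦ ?_
    refine le_trans (le_of_eq ?_) ((hx a b k hk).2 hk')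
    rw [hN]
    push_cast
    rw [pow_succ' (4 : ℝ) m]
    ring

/-- Lipschitz maps on subsets `S n` of `[0, 2⁻ⁿ]` with values close to a common point can be
concatenated. -/
theorem exists_lipschitzOnWith_iUnion_image_subset {X : Type*} [MetricSpace X] {p : X}
    {S : ℕ → Set ℝ} {g : ℕ → ℝ → X} (hS : ∀ n, S n ⊆ Set.Icc 0 ((1 / 2) ^ n))
    (hg : ∀ n, LipschitzOnWith 1 (g n) (S n))
    (hgp : ∀ n, Set.MapsTo (g n) (S n) (Metric.closedBall p ((1 / 2) ^ n))) :
    ∃ (T : Set ℝ) (f : ℝ → X), T ⊆ Set.Icc 0 4 ∧ LipschitzOnWith 2 f T ∧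
      f '' T = ⋃ n, g n '' S n := by
  let φ : (Σ n, S n) → ℝ := fun z ↦ 3 * (1 / 2) ^ z.1 + z.2
  let G : (Σ n, S n) → X := fun z ↦ g z.1 z.2
  have hlt : ∀ z w : Σ n, S n, z.1 < w.1 → dist (G z) (G w) ≤ 2 * dist (φ z) (φ w) := by
    rintro ⟨m, s, hs⟩ ⟨n, t, ht⟩ hmn
    have hpow : ((1 : ℝ) / 2) ^ n ≤ (1 / 2) ^ m / 2 := by
      calc ((1 : ℝ) / 2) ^ n ≤ (1 / 2) ^ (m + 1) :=
            pow_le_pow_of_le_one (by norm_num) (by norm_num) hmn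
        _ = _ := by ring
    have h1 := (hS m hs).1
    have h2 := (hS n ht).2
    have h3 : dist (g m s) p ≤ _ := hgp m hs
    have h4 : dist (g n t) p ≤ _ := hgp n ht
    have h5 := dist_triangle_right (g m s) (g n t) p
    have h6 := le_abs_self ((3 * (1 / 2) ^ m + s) - (3 * (1 / 2) ^ n + t))
    have h7 : (0 : ℝ) < (1 / 2) ^ m := by positivity
    simp only [φ, G, Real.dist_eq]
    linarith
  have hdist : ∀ z w, dist (G z) (G w) ≤ 2 * dist (φ z) (φ w) := by
    intro z w
    rcases lt_trichotomy z.1 w.1 with h | h | h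
    · exact hlt z w h
    · obtain ⟨m, s⟩ := z
      obtain ⟨n, t⟩ := w
      obtain rfl : m = n := h
      have := (hg m).dist_le_mul s s.2 t t.2
      simp only [φ, G, dist_add_left]
      rw [NNReal.coe_one, one_mul] at this
      linarith [dist_nonneg (x := (s : ℝ)) (y := t)]
    · rw [dist_comm, dist_comm (φ z)]
      exact hlt w z h
  have : Nonempty X := ⟨p⟩
  have hfac : Function.FactorsThrough G φ := fun z w hzw ↦
    dist_le_zero.mp (by simpa [hzw] using hdist z w)
  have hext : ∀ z, Function.extend φ G (fun _ ↦ p) (φ z) = G z := hfac.extend_apply _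
  refine ⟨Set.range φ, Function.extend φ G fun _ ↦ p, ?_, ?_, ?_⟩
  · rintro _ ⟨⟨n, s, hs⟩, rfl⟩
    have h1 : ((1 : ℝ) / 2) ^ n ≤ 1 := pow_le_one₀ (by norm_num) (by norm_num)
    have h2 : (0 : ℝ) < (1 / 2) ^ n := by positivity
    have h3 := hS n hs
    simp only [φ]
    exact ⟨by linarith [h3.1], by linarith [h3.2]⟩
  · refine LipschitzOnWith.of_dist_le_mul ?_
    rintro _ ⟨z, rfl⟩ _ ⟨w, rfl⟩
    rw [hext, hext]
    exact hdist z w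
  · ext y
    simp only [Set.mem_image, Set.mem_range, exists_exists_eq_and, hext, Set.mem_iUnion, G]
    constructor
    · rintro ⟨⟨n, s⟩, rfl⟩
      exact ⟨n, s, s.2, rfl⟩
    · rintro ⟨n, s, hs, rfl⟩
      exact ⟨⟨n, s, hs⟩, rfl⟩

/-- For any non-degenerate continuum `K ⊆ ℝ^d` (compact, connected, with more than one
point) there exists a rectifiable curve (the image of a Lipschitz map from a compact
real interval) whose intersection with `K` has Hausdorff dimension `1`. -/
theorem rectifiable_curve_inter_continuum_dimH_eq_one
    (d : ℕ) (K : Set (EuclideanSpace ℝ (Fin d)))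
    (hKcomp : IsCompact K) (hKconn : IsConnected K) (hKnt : K.Nontrivial) :
    ∃ (a b : ℝ) (f : ℝ → EuclideanSpace ℝ (Fin d)) (C : NNReal),
      a ≤ b ∧ LipschitzOnWith C f (Set.Icc a b) ∧
      dimH (f '' Set.Icc a b ∩ K) = 1 := by
  obtain ⟨p, hp, q, hq, hpq⟩ := hKnt
  have hpos : ∀ n : ℕ, (0 : ℝ) < (1 / 2) ^ n := fun n ↦ by positivity
  choose S g hS hg hmaps hdim using fun n : ℕ ↦ exists_lipschitzOnWith_le_dimH_image hKcomp
    hKconn.isPreconnected hp hq hpq.symm (hpos n) n.succ_pos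
  obtain ⟨T, f, hT, hf, hfT⟩ := exists_lipschitzOnWith_iUnion_image_subset hS hg
    fun n ↦ (hmaps n).mono_right Set.inter_subset_right
  obtain ⟨F, hF, hfF⟩ := hf.extend_finite_dimension
  refine ⟨0, 4, F, _, by norm_num, hF.lipschitzOnWith, le_antisymm ?_ ?_⟩
  · calc dimH (F '' Set.Icc 0 4 ∩ K) ≤ dimH (F '' Set.Icc 0 4) := dimH_mono Set.inter_subset_left
      _ ≤ dimH (Set.Icc (0 : ℝ) 4) := hF.dimH_image_le _
      _ ≤ dimH (Set.univ : Set ℝ) := dimH_mono (Set.subset_univ _)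
      _ = 1 := Real.dimH_univ
  have hsub : ∀ n, g n '' S n ⊆ F '' Set.Icc 0 4 ∩ K := by
    intro n
    refine Set.subset_inter ?_ ((hmaps n).mono_right Set.inter_subset_left).image_subset
    calc g n '' S n ⊆ f '' T := hfT ▸ Set.subset_iUnion (fun n ↦ g n '' S n) n
      _ = F '' T := hfF.image_eq
      _ ⊆ F '' Set.Icc 0 4 := Set.image_mono hT
  have hle : ∀ n : ℕ, (((n.succ : ℕ) / ((n.succ : ℕ) + 1) : NNReal) : ENNReal) ≤
      dimH (F '' Set.Icc 0 4 ∩ K) := fun n ↦ (hdim n).trans (dimH_mono (hsub n))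
  refine le_of_tendsto' (x := Filter.atTop) ?_ hle
  rw [← ENNReal.coe_one, ENNReal.tendsto_coe, ← NNReal.tendsto_coe]
  simp only [NNReal.coe_div, NNReal.coe_add, NNReal.coe_natCast, NNReal.coe_one]
  exact (tendsto_natCast_div_add_atTop (1 : ℝ)).comp (Filter.tendsto_add_atTop_nat 1)
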